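/- arXiv:2312.08280 — 8 statements merged into one kernel-verified Lean document; each statement's English description precedes it below -/
import Mathlib

section
/- Well-balancedness of the one-dimensional central-upwind scheme (Theorem 6.1): let g > 0, Δx > 0, fix weights c_1, c_2, c_3 ≥ 0, and for every j ∈ ℤ and i ∈ {1,2,3} let Z_{j+1/2,i} ∈ ℝ and w_i ∈ ℝ (independent of j) be given, with h_{j+1/2,i} := w_i − Z_{j+1/2,i}. Assume the one-sided interface states from both sides of every interface coincide and are at rest, U⁻_{j+1/2,i} = U⁺_{j+1/2,i} = (h_{j+1/2,i}, 0), and let a⁻_{j+1/2} ≤ 0 ≤ a⁺_{j+1/2} be reals with a⁺_{j+1/2} ≠ a⁻_{j+1/2}. Define the numerical flux 𝓕_{j+1/2} = Σ_{i=1}^{3} c_i · [ (a⁺_{j+1/2} F(U⁻_{j+1/2,i}) − a⁻_{j+1/2} F(U⁺_{j+1/2,i}))/(a⁺_{j+1/2} − a⁻_{j+1/2}) + (a⁺_{j+1/2} a⁻_{j+1/2}/(a⁺_{j+1/2} − a⁻_{j+1/2}))·(U⁺_{j+1/2,i} − U⁻_{j+1/2,i}) ] and the discrete source S̄_j = (1/Δx)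 Σ_{i=1}^{3} c_i · (0, −(g/2)(h_{j−1/2,i} + h_{j+1/2,i})(Z_{j+1/2,i} − Z_{j−1/2,i})). Then for every j ∈ ℤ, −(𝓕_{j+1/2} − 𝓕_{j−1/2})/Δx + S̄_j = (0, 0), i.e., the right-hand side of the semi-discrete scheme vanishes at a discrete 'lake-at-rest' steady state, so the scheme is well-balanced. -/
/-- Well-balancedness of the one-dimensional central-upwind scheme (Theorem 6.1):
at a discrete "lake-at-rest" steady state, the right-hand side of the semi-discrete
scheme vanishes. Here `Flux j` stands for `𝓕_{j+1/2}`, `Z j i` for `Z_{j+1/2,i}`,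
`h j i` for `h_{j+1/2,i}`, and `am j ≤ 0 ≤ ap j` are the one-sided local speeds
`a∓_{j+1/2}`. -/
theorem wellBalanced_1d_1random
    (g Δx : ℝ) (hg : 0 < g) (hΔx : 0 < Δx)
    (c : Fin 3 → ℝ) (hc : ∀ i, 0 ≤ c i)
    (w : Fin 3 → ℝ) (Z : ℤ → Fin 3 → ℝ)
    (h : ℤ → Fin 3 → ℝ) (hdef : ∀ j i, h j i = w i - Z j i)
    (am ap : ℤ → ℝ) (ham : ∀ j, am j ≤ 0) (hap : ∀ j, 0 ≤ ap j)
    (hne : ∀ j, ap j ≠ am j)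
    (F : ℝ × ℝ → ℝ × ℝ) (hF : ∀ d : ℝ, F (d, 0) = (0, g / 2 * d ^ 2))
    (Um Up : ℤ → Fin 3 → ℝ × ℝ)
    (hUm : ∀ j i, Um j i = (h j i, 0))
    (hUp : ∀ j i, Up j i = (h j i, 0))
    (Flux : ℤ → ℝ × ℝ)
    (hFlux : ∀ j, Flux j =
      ∑ i, c i • ((ap j - am j)⁻¹ • (ap j • F (Um j i) - am j • F (Up j i))
        + (ap j * am j / (ap j - am j)) • (Up j i - Um j i)))
    (S : ℤ → ℝ × ℝ)
    (hS : ∀ j, S j = (1 / Δx) •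
      ∑ i, c i • ((0 : ℝ), -(g / 2) * (h (j - 1) i + h j i) * (Z j i - Z (j - 1) i))) :
    ∀ j : ℤ, (-(1 / Δx)) • (Flux j - Flux (j - 1)) + S j = ((0 : ℝ), (0 : ℝ)) := by
  have flux_eq : ∀ j, Flux j = ∑ i, c i • ((0 : ℝ), g / 2 * h j i ^ 2) := by
    intro j
    rw [hFlux j]
    refine Finset.sum_congr rfl fun i _ => ?_
    rw [hUm, hUp, hF, sub_self, smul_zero, add_zero, ← sub_smul,
      inv_smul_smul₀ (sub_ne_zero.mpr (hne j))]
  intro j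
  rw [flux_eq, flux_eq, hS, neg_smul, ← smul_neg, ← smul_add, ← Finset.sum_sub_distrib,
    ← Finset.sum_neg_distrib, ← Finset.sum_add_distrib, Finset.sum_eq_zero, smul_zero]
  · rfl
  · intro i _
    ext
    · simp
    · simp only [hdef, Prod.snd_add, Prod.snd_neg, Prod.snd_sub, Prod.smul_snd, smul_eq_mul,
        Prod.snd_zero]
      ring
end

section
/- Well-balancedness of the scheme with one spatial and two random variables (Theorem 6.2): let g > 0, Δx > 0, fix weights c_{i,r} ≥ 0 for i, r ∈ {1,2,3}, and for every j ∈ ℤ and every pair (i,r) let Z_{j+1/2,i,r} ∈ ℝ and w_{i,r} ∈ ℝ (independent of j) be given, with h_{j+1/2,i,r} := w_{i,r} − Z_{j+1/2,i,r}. Assume the one-sided interface states from both sides of every interface coincide and are at rest, U⁻_{j+1/2,i,r} = U⁺_{j+1/2,i,r} = (h_{j+1/2,i,r}, 0), and let a⁻_{j+1/2} ≤ 0 ≤ a⁺_{j+1/2} be reals with a⁺_{j+1/2} ≠ a⁻_{j+1/2}. Define the numerical flux 𝓕_{j+1/2} = Σ_{i,r=1}^{3} c_{i,r} · [ (a⁺_{j+1/2}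 F(U⁻_{j+1/2,i,r}) − a⁻_{j+1/2} F(U⁺_{j+1/2,i,r}))/(a⁺_{j+1/2} − a⁻_{j+1/2}) + (a⁺_{j+1/2} a⁻_{j+1/2}/(a⁺_{j+1/2} − a⁻_{j+1/2}))·(U⁺_{j+1/2,i,r} − U⁻_{j+1/2,i,r}) ] and the discrete source S̄_j = (1/Δx) Σ_{i,r=1}^{3} c_{i,r} · (0, −(g/2)(h_{j−1/2,i,r} + h_{j+1/2,i,r})(Z_{j+1/2,i,r} − Z_{j−1/2,i,r})). Then for every j ∈ ℤ, −(𝓕_{j+1/2} − 𝓕_{j−1/2})/Δx + S̄_j = (0, 0), i.e., the right-hand side of the semi-discrete scheme vanishes at a discrete 'lake-at-rest' steady state, so the scheme is well-balanced. -/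
/-- The weighted combination `(a • v - b • v) / (a - b)` of two equal values `v` is `v`. -/
theorem inv_sub_smul_smul_sub_smul {E : Type*} [AddCommGroup E] [Module ℝ E] {a b : ℝ}
    (hab : a ≠ b) (v : E) : (a - b)⁻¹ • (a • v - b • v) = v := by
  rw [← sub_smul, inv_smul_smul₀ (sub_ne_zero.mpr hab)]


/-- Well-balancedness of the scheme with one spatial and two random variables
(Theorem 6.2): at a discrete "lake-at-rest" steady state, the right-hand side of
the semi-discrete scheme vanishes. Here `Flux j` stands for `𝓕_{j+1/2}`,
`Z j i r` for `Z_{j+1/2,i,r}`, `h j i r` for `h_{j+1/2,i,r}`, and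
`am j ≤ 0 ≤ ap j` are the one-sided local speeds `a∓_{j+1/2}`. -/
theorem wellBalanced_1d_2random
    (g Δx : ℝ) (hg : 0 < g) (hΔx : 0 < Δx)
    (c : Fin 3 → Fin 3 → ℝ) (hc : ∀ i r, 0 ≤ c i r)
    (w : Fin 3 → Fin 3 → ℝ) (Z : ℤ → Fin 3 → Fin 3 → ℝ)
    (h : ℤ → Fin 3 → Fin 3 → ℝ) (hdef : ∀ j i r, h j i r = w i r - Z j i r)
    (am ap : ℤ → ℝ) (ham : ∀ j, am j ≤ 0) (hap : ∀ j, 0 ≤ ap j)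
    (hne : ∀ j, ap j ≠ am j)
    (F : ℝ × ℝ → ℝ × ℝ) (hF : ∀ d : ℝ, F (d, 0) = (0, g / 2 * d ^ 2))
    (Um Up : ℤ → Fin 3 → Fin 3 → ℝ × ℝ)
    (hUm : ∀ j i r, Um j i r = (h j i r, 0))
    (hUp : ∀ j i r, Up j i r = (h j i r, 0))
    (Flux : ℤ → ℝ × ℝ)
    (hFlux : ∀ j, Flux j =
      ∑ i, ∑ r, c i r •
        ((ap j - am j)⁻¹ • (ap j • F (Um j i r) - am j • F (Up j i r))
          + (ap j * am j / (ap j - am j)) • (Up j i r - Um j i r)))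
    (S : ℤ → ℝ × ℝ)
    (hS : ∀ j, S j = (1 / Δx) •
      ∑ i, ∑ r, c i r •
        ((0 : ℝ), -(g / 2) * (h (j - 1) i r + h j i r) * (Z j i r - Z (j - 1) i r))) :
    ∀ j : ℤ, (-(1 / Δx)) • (Flux j - Flux (j - 1)) + S j = ((0 : ℝ), (0 : ℝ)) := by
  intro j
  have flux_eq : ∀ k, Flux k = ∑ i, ∑ r, c i r • ((0 : ℝ), g / 2 * h k i r ^ 2) := by
    intro k
    simp only [hFlux, hUm, hUp, hF, sub_self, smul_zero, add_zero,
      inv_sub_smul_smul_sub_smul (hne k)]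
  have source_eq : ∑ i, ∑ r, c i r •
      ((0 : ℝ), -(g / 2) * (h (j - 1) i r + h j i r) * (Z j i r - Z (j - 1) i r)) =
      Flux j - Flux (j - 1) := by
    simp only [flux_eq, ← Finset.sum_sub_distrib, ← smul_sub]
    refine Finset.sum_congr rfl fun i _ => Finset.sum_congr rfl fun r _ => ?_
    congr 1
    ext
    · simp
    · simp only [hdef, Prod.snd_sub]
      ring
  rw [hS, source_eq, neg_smul, neg_add_cancel, Prod.mk_zero_zero]
end

section
/- Well-balancedness of the two-dimensional central-upwind scheme (Theorem 6.3): let g > 0, Δx > 0, Δy > 0, fix weights c_1, c_2, c_3 ≥ 0, and for every (j,k) ∈ ℤ² and i ∈ {1,2,3} let Z_{j+1/2,k,i} ∈ ℝ, Z_{j,k+1/2,i} ∈ ℝ and w_i ∈ ℝ (independent of j and k) be given, with h_{j+1/2,k,i} := w_i − Z_{j+1/2,k,i} and h_{j,k+1/2,i} := w_i − Z_{j,k+1/2,i}. Assume the one-sided interface states from both sides of every x- and y-interface coincide and are at rest, namely (h_{j+1/2,k,i}, 0, 0) and (h_{j,k+1/2,i}, 0, 0) respectively, and let a⁻_{j+1/2,k}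 ≤ 0 ≤ a⁺_{j+1/2,k} and a⁻_{j,k+1/2} ≤ 0 ≤ a⁺_{j,k+1/2} be reals with a⁺ ≠ a⁻ at every interface. Define the x-flux 𝓕_{j+1/2,k} = Σ_i c_i · [ (a⁺_{j+1/2,k} F(U⁻) − a⁻_{j+1/2,k} F(U⁺))/(a⁺_{j+1/2,k} − a⁻_{j+1/2,k}) + (a⁺_{j+1/2,k} a⁻_{j+1/2,k}/(a⁺_{j+1/2,k} − a⁻_{j+1/2,k}))(U⁺ − U⁻) ] with U± = (h_{j+1/2,k,i}, 0, 0), the y-flux 𝓖_{j,k+1/2} analogously with G in place of F and U± = (h_{j,k+1/2,i}, 0, 0), and the discrete source S̄_{j,k} = (1/(ΔxΔy)) Σ_i c_i · (0, −(gΔy/2)(h_{j−1/2,k,i} + h_{j+1/2,k,i})(Z_{j+1/2,k,i} − Z_{j−1/2,k,i}), −(gΔx/2)(h_{j,k−1/2,i} + h_{j,k+1/2,i})(Z_{j,k+1/2,i} − Z_{j,k−1/2,i})). Then for every (j,k), −(𝓕_{j+1/2,k} − 𝓕_{j−1/2,k})/Δx − (𝓖_{j,k+1/2} − 𝓖_{j,k−1/2})/Δy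 + S̄_{j,k} = (0, 0, 0), i.e., the right-hand side of the semi-discrete scheme vanishes at a discrete 'lake-at-rest' steady state, so the scheme is well-balanced. -/
/-- The central-upwind numerical flux is consistent: if both one-sided states coincide,
it returns the physical flux of the common state. -/
lemma centralUpwind_flux_self {E : Type*} [AddCommGroup E] [Module ℝ E] {am ap : ℝ}
    (h : ap ≠ am) (f u : E) :
    (ap - am)⁻¹ • (ap • f - am • f) + (ap * am / (ap - am)) • (u - u) = f := by
  rw [← sub_smul, smul_smul, inv_mul_cancel₀ (sub_ne_zero.2 h), one_smul, sub_self, smul_zero,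
    add_zero]

/-- Well-balancedness of the two-dimensional central-upwind scheme (Theorem 6.3):
at a discrete "lake-at-rest" steady state, the right-hand side of the semi-discrete
scheme vanishes. Here `Fl j k` stands for `𝓕_{j+1/2,k}`, `Gl j k` for `𝓖_{j,k+1/2}`,
`Zx j k i` for `Z_{j+1/2,k,i}`, `Zy j k i` for `Z_{j,k+1/2,i}`, similarly for the
water depths `hx`, `hy`, and `amx j k ≤ 0 ≤ apx j k`, `amy j k ≤ 0 ≤ apy j k` are
the one-sided local speeds at the x- and y-interfaces. -/
theorem wellBalanced_2d_1random
    (g Δx Δy : ℝ) (hg : 0 < g) (hΔx : 0 < Δx) (hΔy : 0 < Δy)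
    (c : Fin 3 → ℝ) (hc : ∀ i, 0 ≤ c i)
    (w : Fin 3 → ℝ)
    (Zx Zy : ℤ → ℤ → Fin 3 → ℝ)
    (hx hy : ℤ → ℤ → Fin 3 → ℝ)
    (hhx : ∀ j k i, hx j k i = w i - Zx j k i)
    (hhy : ∀ j k i, hy j k i = w i - Zy j k i)
    (amx apx amy apy : ℤ → ℤ → ℝ)
    (hamx : ∀ j k, amx j k ≤ 0) (hapx : ∀ j k, 0 ≤ apx j k)
    (hamy : ∀ j k, amy j k ≤ 0) (hapy : ∀ j k, 0 ≤ apy j k)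
    (hnex : ∀ j k, apx j k ≠ amx j k) (hney : ∀ j k, apy j k ≠ amy j k)
    (F G : ℝ × ℝ × ℝ → ℝ × ℝ × ℝ)
    (hF : ∀ d : ℝ, F (d, 0, 0) = (0, g / 2 * d ^ 2, 0))
    (hG : ∀ d : ℝ, G (d, 0, 0) = (0, 0, g / 2 * d ^ 2))
    (Fl Gl : ℤ → ℤ → ℝ × ℝ × ℝ)
    (hFl : ∀ j k, Fl j k =
      ∑ i, c i •
        ((apx j k - amx j k)⁻¹ •
            (apx j k • F (hx j k i, 0, 0) - amx j k • F (hx j k i, 0, 0))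
          + (apx j k * amx j k / (apx j k - amx j k)) •
              (((hx j k i, 0, 0) : ℝ × ℝ × ℝ) - (hx j k i, 0, 0))))
    (hGl : ∀ j k, Gl j k =
      ∑ i, c i •
        ((apy j k - amy j k)⁻¹ •
            (apy j k • G (hy j k i, 0, 0) - amy j k • G (hy j k i, 0, 0))
          + (apy j k * amy j k / (apy j k - amy j k)) •
              (((hy j k i, 0, 0) : ℝ × ℝ × ℝ) - (hy j k i, 0, 0))))
    (S : ℤ → ℤ → ℝ × ℝ × ℝ)
    (hS : ∀ j k, S j k = (1 / (Δx * Δy)) •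
      ∑ i, c i •
        ((0 : ℝ),
          -(g * Δy / 2) * (hx (j - 1) k i + hx j k i) * (Zx j k i - Zx (j - 1) k i),
          -(g * Δx / 2) * (hy j (k - 1) i + hy j k i) * (Zy j k i - Zy j (k - 1) i))) :
    ∀ j k : ℤ,
      (-(1 / Δx)) • (Fl j k - Fl (j - 1) k) + (-(1 / Δy)) • (Gl j k - Gl j (k - 1))
        + S j k = ((0 : ℝ), (0 : ℝ), (0 : ℝ)) := by
  intro j k
  simp only [centralUpwind_flux_self (hnex _ _), hF] at hFl
  simp only [centralUpwind_flux_self (hney _ _), hG] at hGl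
  simp only [hFl, hGl, hS, hhx, hhy, Fin.sum_univ_three, Prod.smul_mk, Prod.mk_add_mk,
    Prod.mk_sub_mk, smul_eq_mul, Prod.mk.injEq]
  refine ⟨by ring, ?_, ?_⟩ <;> field_simp <;> ring
end

section
/- Fifth-order exactness and uniqueness of the interior linear WENO weights: let Δξ > 0, let ξ_m = ξ_0 + mΔξ be equispaced nodes, let κ = (1/2)√(3/5), fix ℓ, and for real values U_{ℓ−2}, …, U_{ℓ+2} let P_0, P_1, P_2 be the quadratic interpolants on the stencils {ξ_{ℓ−2}, ξ_{ℓ−1}, ξ_ℓ}, {ξ_{ℓ−1}, ξ_ℓ, ξ_{ℓ+1}}, {ξ_ℓ, ξ_{ℓ+1}, ξ_{ℓ+2}} and let Q be the quartic interpolant of all five values on {ξ_{ℓ−2}, …, ξ_{ℓ+2}}. Define d_{0,±} = (43 ∓ 6√15)/240, d_{1,±} = 77/120, d_{2,±} = (43 ± 6√15)/240. Then (i) all d_{i,±} are positive and d_{0,±} + d_{1,±} + d_{2,±} = 1; (ii) for both sign choices and for every choice of the five values, d_{0,±} P_0(ξ_ℓ ± κΔξ) + d_{1,±} P_1(ξ_ℓ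 ± κΔξ) + d_{2,±} P_2(ξ_ℓ ± κΔξ) = Q(ξ_ℓ ± κΔξ); (iii) for each sign, (d_{0,±}, d_{1,±}, d_{2,±}) is the unique triple of reals for which the identity in (ii) holds for every choice of the five values. -/
open Polynomial in
/-- `P0`, `P1`, `P2` are the quadratic interpolants of the quartic `Q` on the three substencils
of the five equispaced nodes centred at `x` with spacing `h`. -/
structure AreSubstencilInterpolants (h x : ℝ) (P0 P1 P2 Q : ℝ[X]) : Prop where
  degree_left : P0.degree ≤ 2
  degree_mid : P1.degree ≤ 2
  degree_right : P2.degree ≤ 2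
  degree_full : Q.degree ≤ 4
  left : P0.eval (x - 2 * h) = Q.eval (x - 2 * h) ∧ P0.eval (x - h) = Q.eval (x - h) ∧
    P0.eval x = Q.eval x
  mid : P1.eval (x - h) = Q.eval (x - h) ∧ P1.eval x = Q.eval x ∧
    P1.eval (x + h) = Q.eval (x + h)
  right : P2.eval x = Q.eval x ∧ P2.eval (x + h) = Q.eval (x + h) ∧
    P2.eval (x + 2 * h) = Q.eval (x + 2 * h)

/-- Lagrange's formula for quadratics on three equispaced nodes. -/
lemma Polynomial.eval_add_mul_of_degree_le_two {p : Polynomial ℝ} (hp : p.degree ≤ 2)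
    (x h t : ℝ) :
    p.eval (x + t * h) = t * (t - 1) / 2 * p.eval (x - h) + (1 - t ^ 2) * p.eval x
      + t * (t + 1) / 2 * p.eval (x + h) := by
  have hn : p.natDegree < 3 := Nat.lt_succ_of_le (Polynomial.natDegree_le_of_degree_le hp)
  simp only [Polynomial.eval_eq_sum_range' hn, Finset.sum_range_succ, Finset.sum_range_zero]
  ring

/-- Lagrange's formula for quartics on five equispaced nodes. -/
lemma Polynomial.eval_add_mul_of_degree_le_four {p : Polynomial ℝ} (hp : p.degree ≤ 4)
    (x h t : ℝ) :
    p.eval (x + t * h) =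
      (t + 1) * t * (t - 1) * (t - 2) / 24 * p.eval (x - 2 * h)
      - (t + 2) * t * (t - 1) * (t - 2) / 6 * p.eval (x - h)
      + (t + 2) * (t + 1) * (t - 1) * (t - 2) / 4 * p.eval x
      - (t + 2) * (t + 1) * t * (t - 2) / 6 * p.eval (x + h)
      + (t + 2) * (t + 1) * t * (t - 1) / 24 * p.eval (x + 2 * h) := by
  have hn : p.natDegree < 5 := Nat.lt_succ_of_le (Polynomial.natDegree_le_of_degree_le hp)
  simp only [Polynomial.eval_eq_sum_range' hn, Finset.sum_range_succ, Finset.sum_range_zero]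
  ring

namespace AreSubstencilInterpolants

/-- The linear weights at offset `t` reproduce the quartic interpolant. -/
lemma weighted_eval_eq {h x : ℝ} {P0 P1 P2 Q : Polynomial ℝ}
    (H : AreSubstencilInterpolants h x P0 P1 P2 Q) (t : ℝ) :
    (t - 1) * (t - 2) / 12 * P0.eval (x + t * h) + (4 - t ^ 2) / 6 * P1.eval (x + t * h)
      + (t + 1) * (t + 2) / 12 * P2.eval (x + t * h) = Q.eval (x + t * h) := by
  obtain ⟨a0, a1, a2⟩ := H.left
  obtain ⟨b0, b1, b2⟩ := H.mid
  obtain ⟨c0, c1, c2⟩ := H.right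
  have h0 := Polynomial.eval_add_mul_of_degree_le_two H.degree_left (x - h) h (t + 1)
  have h1 := Polynomial.eval_add_mul_of_degree_le_two H.degree_mid x h t
  have h2 := Polynomial.eval_add_mul_of_degree_le_two H.degree_right (x + h) h (t - 1)
  rw [show x - h + (t + 1) * h = x + t * h by ring, show x - h - h = x - 2 * h by ring,
    sub_add_cancel, a0, a1, a2] at h0
  rw [b0, b1, b2] at h1
  rw [show x + h + (t - 1) * h = x + t * h by ring, show x + h + h = x + 2 * h by ring,
    add_sub_cancel_right, c0, c1, c2] at h2
  rw [h0, h1, h2, Polynomial.eval_add_mul_of_degree_le_four H.degree_full x h t]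
  ring

open Polynomial in
/-- The linear weights at an offset `t` that is not one of the three central nodes are unique. -/
lemma weights_unique {h x t : ℝ} (hh : h ≠ 0) (ht : t ≠ 0) (ht1 : t + 1 ≠ 0) (ht2 : t - 1 ≠ 0)
    {e0 e1 e2 : ℝ}
    (H : ∀ P0 P1 P2 Q : ℝ[X], AreSubstencilInterpolants h x P0 P1 P2 Q →
      e0 * P0.eval (x + t * h) + e1 * P1.eval (x + t * h) + e2 * P2.eval (x + t * h)
        = Q.eval (x + t * h)) :
    e0 = (t - 1) * (t - 2) / 12 ∧ e1 = (4 - t ^ 2) / 6 ∧ e2 = (t + 1) * (t + 2) / 12 := by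
  have E0 : e0 = (t - 1) * (t - 2) / 12 := by
    have := H (C (12 * h ^ 2) * (X - C x) * (X - C (x - h))) 0 0
      ((X - C x) * (X - C (x - h)) * (X - C (x + h)) * (X - C (x + 2 * h)))
      { degree_left := by compute_degree
        degree_mid := by simp
        degree_right := by simp
        degree_full := by compute_degree
        left := by simp; ring
        mid := by simp
        right := by simp }
    simp only [eval_mul, eval_sub, eval_X, eval_C, eval_zero] at this
    have hne : 12 * h ^ 4 * (t * (t + 1)) ≠ 0 := by positivity
    apply mul_left_cancel₀ hne
    linear_combination this
  have E2 : e2 = (t + 1) * (t + 2) / 12 := by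
    have := H 0 0 (C (12 * h ^ 2) * (X - C x) * (X - C (x + h)))
      ((X - C x) * (X - C (x + h)) * (X - C (x - h)) * (X - C (x - 2 * h)))
      { degree_left := by simp
        degree_mid := by simp
        degree_right := by compute_degree
        degree_full := by compute_degree
        left := by simp
        mid := by simp
        right := by simp; ring }
    simp only [eval_mul, eval_sub, eval_X, eval_C, eval_zero] at this
    have hne : 12 * h ^ 4 * (t * (t - 1)) ≠ 0 := by positivity
    apply mul_left_cancel₀ hne
    linear_combination this
  have E : e0 + e1 + e2 = 1 := by
    simpa using H 1 1 1 1
      { degree_left := by simp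
        degree_mid := by simp
        degree_right := by simp
        degree_full := by simp
        left := by simp
        mid := by simp
        right := by simp }
  exact ⟨E0, by linear_combination E - E0 - E2, E2⟩

end AreSubstencilInterpolants

/-- Fifth-order exactness and uniqueness of the interior linear WENO weights:
with equispaced nodes of spacing `Δξ` (here `xl = ξ_ℓ`), `κ = (1/2)√(3/5)`, and the
linear weights `d_{0,±} = (43 ∓ 6√15)/240`, `d_{1,±} = 77/120`,
`d_{2,±} = (43 ± 6√15)/240`:
(i) all the weights are positive and each triple sums to 1;
(ii) for both sign choices and every choice of five values, the weighted combination
of the three quadratic substencil interpolants at `ξ_ℓ ± κΔξ` equals the value of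
the five-point quartic interpolant there;
(iii) for each sign, these weights are the unique such triple. -/
theorem interior_linear_WENO_weights
    (Δξ xl : ℝ) (hΔ : 0 < Δξ) (κ : ℝ) (hκ : κ = 1 / 2 * Real.sqrt (3 / 5))
    (d0p d1p d2p d0m d1m d2m : ℝ)
    (hd0p : d0p = (43 - 6 * Real.sqrt 15) / 240) (hd1p : d1p = 77 / 120)
    (hd2p : d2p = (43 + 6 * Real.sqrt 15) / 240)
    (hd0m : d0m = (43 + 6 * Real.sqrt 15) / 240) (hd1m : d1m = 77 / 120)
    (hd2m : d2m = (43 - 6 * Real.sqrt 15) / 240) :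
    -- (i) positivity and normalization
    (0 < d0p ∧ 0 < d1p ∧ 0 < d2p ∧ 0 < d0m ∧ 0 < d1m ∧ 0 < d2m ∧
      d0p + d1p + d2p = 1 ∧ d0m + d1m + d2m = 1) ∧
    -- (ii) fifth-order exactness, both signs
    (∀ (Um2 Um1 U0 Up1 Up2 : ℝ) (P0 P1 P2 Q : Polynomial ℝ),
      (P0.degree ≤ 2 ∧ P0.eval (xl - 2 * Δξ) = Um2 ∧ P0.eval (xl - Δξ) = Um1 ∧
        P0.eval xl = U0) →
      (P1.degree ≤ 2 ∧ P1.eval (xl - Δξ) = Um1 ∧ P1.eval xl = U0 ∧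
        P1.eval (xl + Δξ) = Up1) →
      (P2.degree ≤ 2 ∧ P2.eval xl = U0 ∧ P2.eval (xl + Δξ) = Up1 ∧
        P2.eval (xl + 2 * Δξ) = Up2) →
      (Q.degree ≤ 4 ∧ Q.eval (xl - 2 * Δξ) = Um2 ∧ Q.eval (xl - Δξ) = Um1 ∧
        Q.eval xl = U0 ∧ Q.eval (xl + Δξ) = Up1 ∧ Q.eval (xl + 2 * Δξ) = Up2) →
      (d0p * P0.eval (xl + κ * Δξ) + d1p * P1.eval (xl + κ * Δξ)
          + d2p * P2.eval (xl + κ * Δξ) = Q.eval (xl + κ * Δξ)) ∧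
      (d0m * P0.eval (xl - κ * Δξ) + d1m * P1.eval (xl - κ * Δξ)
          + d2m * P2.eval (xl - κ * Δξ) = Q.eval (xl - κ * Δξ))) ∧
    -- (iii) uniqueness, plus sign
    (∀ e0 e1 e2 : ℝ,
      (∀ (Um2 Um1 U0 Up1 Up2 : ℝ) (P0 P1 P2 Q : Polynomial ℝ),
        (P0.degree ≤ 2 ∧ P0.eval (xl - 2 * Δξ) = Um2 ∧ P0.eval (xl - Δξ) = Um1 ∧
          P0.eval xl = U0) →
        (P1.degree ≤ 2 ∧ P1.eval (xl - Δξ) = Um1 ∧ P1.eval xl = U0 ∧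
          P1.eval (xl + Δξ) = Up1) →
        (P2.degree ≤ 2 ∧ P2.eval xl = U0 ∧ P2.eval (xl + Δξ) = Up1 ∧
          P2.eval (xl + 2 * Δξ) = Up2) →
        (Q.degree ≤ 4 ∧ Q.eval (xl - 2 * Δξ) = Um2 ∧ Q.eval (xl - Δξ) = Um1 ∧
          Q.eval xl = U0 ∧ Q.eval (xl + Δξ) = Up1 ∧ Q.eval (xl + 2 * Δξ) = Up2) →
        e0 * P0.eval (xl + κ * Δξ) + e1 * P1.eval (xl + κ * Δξ)
          + e2 * P2.eval (xl + κ * Δξ) = Q.eval (xl + κ * Δξ)) →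
      e0 = d0p ∧ e1 = d1p ∧ e2 = d2p) ∧
    -- (iii) uniqueness, minus sign
    (∀ e0 e1 e2 : ℝ,
      (∀ (Um2 Um1 U0 Up1 Up2 : ℝ) (P0 P1 P2 Q : Polynomial ℝ),
        (P0.degree ≤ 2 ∧ P0.eval (xl - 2 * Δξ) = Um2 ∧ P0.eval (xl - Δξ) = Um1 ∧
          P0.eval xl = U0) →
        (P1.degree ≤ 2 ∧ P1.eval (xl - Δξ) = Um1 ∧ P1.eval xl = U0 ∧
          P1.eval (xl + Δξ) = Up1) →
        (P2.degree ≤ 2 ∧ P2.eval xl = U0 ∧ P2.eval (xl + Δξ) = Up1 ∧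
          P2.eval (xl + 2 * Δξ) = Up2) →
        (Q.degree ≤ 4 ∧ Q.eval (xl - 2 * Δξ) = Um2 ∧ Q.eval (xl - Δξ) = Um1 ∧
          Q.eval xl = U0 ∧ Q.eval (xl + Δξ) = Up1 ∧ Q.eval (xl + 2 * Δξ) = Up2) →
        e0 * P0.eval (xl - κ * Δξ) + e1 * P1.eval (xl - κ * Δξ)
          + e2 * P2.eval (xl - κ * Δξ) = Q.eval (xl - κ * Δξ)) →
      e0 = d0m ∧ e1 = d1m ∧ e2 = d2m) := by
  have hs : Real.sqrt 15 ^ 2 = 15 := Real.sq_sqrt (by norm_num)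
  have hs0 : 0 < Real.sqrt 15 := Real.sqrt_pos.2 (by norm_num)
  have hs4 : Real.sqrt 15 < 4 := by nlinarith
  have hκ' : κ = Real.sqrt 15 / 10 := by
    rw [hκ, show (3 / 5 : ℝ) = 15 / 5 ^ 2 by norm_num, Real.sqrt_div (by norm_num),
      Real.sqrt_sq (by norm_num)]
    ring
  clear hκ
  generalize Real.sqrt 15 = s at *
  have hκ2 : κ ^ 2 = 3 / 20 := by rw [hκ', div_pow, hs]; norm_num
  have w0p : d0p = (κ - 1) * (κ - 2) / 12 := by rw [hd0p]; linear_combination -hκ2 / 12 + hκ' / 4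
  have w1p : d1p = (4 - κ ^ 2) / 6 := by rw [hd1p, hκ2]; norm_num
  have w2p : d2p = (κ + 1) * (κ + 2) / 12 := by rw [hd2p]; linear_combination -hκ2 / 12 - hκ' / 4
  have w0m : d0m = (-κ - 1) * (-κ - 2) / 12 := by
    rw [hd0m]; linear_combination -hκ2 / 12 - hκ' / 4
  have w1m : d1m = (4 - (-κ) ^ 2) / 6 := by rw [hd1m, neg_sq, hκ2]; norm_num
  have w2m : d2m = (-κ + 1) * (-κ + 2) / 12 := by
    rw [hd2m]; linear_combination -hκ2 / 12 + hκ' / 4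
  have hκ0 : 0 < κ := by linarith
  have hκ1 : κ < 1 := by linarith
  have hneg : xl - κ * Δξ = xl + -κ * Δξ := by ring
  refine ⟨⟨by linarith, by linarith, by linarith, by linarith, by linarith, by linarith,
    by linarith, by linarith⟩, ?_, ?_, ?_⟩
  · rintro Um2 Um1 U0 Up1 Up2 P0 P1 P2 Q ⟨g0, a0, a1, a2⟩ ⟨g1, b0, b1, b2⟩ ⟨g2, c0, c1, c2⟩
      ⟨g, q0, q1, q2, q3, q4⟩
    have H : AreSubstencilInterpolants Δξ xl P0 P1 P2 Q :=
      { degree_left := g0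
        degree_mid := g1
        degree_right := g2
        degree_full := g
        left := ⟨a0.trans q0.symm, a1.trans q1.symm, a2.trans q2.symm⟩
        mid := ⟨b0.trans q1.symm, b1.trans q2.symm, b2.trans q3.symm⟩
        right := ⟨c0.trans q2.symm, c1.trans q3.symm, c2.trans q4.symm⟩ }
    rw [hneg, w0p, w1p, w2p, w0m, w1m, w2m]
    exact ⟨H.weighted_eval_eq κ, H.weighted_eval_eq (-κ)⟩
  · intro e0 e1 e2 he
    rw [w0p, w1p, w2p]
    exact AreSubstencilInterpolants.weights_unique hΔ.ne' hκ0.ne' (by positivity) (sub_ne_zero.2 hκ1.ne)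
      fun P0 P1 P2 Q H => he _ _ _ _ _ P0 P1 P2 Q ⟨H.degree_left, H.left⟩ ⟨H.degree_mid, H.mid⟩
        ⟨H.degree_right, H.right⟩ ⟨H.degree_full, rfl, rfl, rfl, rfl, rfl⟩
  · intro e0 e1 e2 he
    rw [hneg] at he
    rw [w0m, w1m, w2m]
    exact AreSubstencilInterpolants.weights_unique hΔ.ne' (neg_ne_zero.2 hκ0.ne') (by linarith [hκ1] : (0 : ℝ) < -κ + 1).ne'
      (by linarith : -κ - 1 < (0 : ℝ)).ne
      fun P0 P1 P2 Q H => he _ _ _ _ _ P0 P1 P2 Q ⟨H.degree_left, H.left⟩ ⟨H.degree_mid, H.mid⟩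
        ⟨H.degree_right, H.right⟩ ⟨H.degree_full, rfl, rfl, rfl, rfl, rfl⟩
end

section
/- Closed-form evaluation of the boundary WENO smoothness indicators on the first boundary cell: let Δξ > 0, let ξ_1, …, ξ_5 be equispaced nodes with spacing Δξ, fix real values U_1, …, U_5, and let P_0, P_1, P_2 be the quadratic interpolants of these values on the stencils {ξ_1, ξ_2, ξ_3}, {ξ_2, ξ_3, ξ_4}, {ξ_3, ξ_4, ξ_5}, respectively. Define β_{i,1} = Σ_{r=1}^{2} (Δξ)^{2r−1} ∫_{ξ_1 − Δξ/2}^{ξ_1 + Δξ/2} (d^r P_i/dξ^r)² dξ. Then β_{0,1} = (1/3)[10U_1² − 31U_1U_2 + 25U_2² + 11U_1U_3 − 19U_2U_3 + 4U_3²], β_{1,1} = (1/3)[22U_2² − 73U_2U_3 + 61U_3² + 29U_2U_4 − 49U_3U_4 + 10U_4²], and β_{2,1} = (1/3)[40U_3² − 139U_3U_4 + 121U_4² + 59U_3U_5 − 103U_4U_5 + 22U_5²]. -/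
open Polynomial in
/-- The smoothness indicator of a quadratic polynomial on the cell of width `h` around `x`, in terms
of its values at the nodes `x + k h`, `x + (k + 1) h`, `x + (k + 2) h`: with `d` the second
difference of the values, the scaled derivative at `x` is `(c - a) / 2 - (k + 1) d`. -/
theorem smoothness_indicator_of_degree_le_two (h x k : ℝ) (P : ℝ[X]) (hP : P.degree ≤ 2)
    {a b c : ℝ} (ha : P.eval (x + k * h) = a) (hb : P.eval (x + (k + 1) * h) = b)
    (hc : P.eval (x + (k + 2) * h) = c) :
    h * (∫ y in (x - h / 2)..(x + h / 2), ((derivative P).eval y) ^ 2)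
        + h ^ 3 * (∫ y in (x - h / 2)..(x + h / 2), ((derivative (derivative P)).eval y) ^ 2)
      = ((c - a) / 2 - (k + 1) * (a - 2 * b + c)) ^ 2 + 13 / 12 * (a - 2 * b + c) ^ 2 := by
  obtain ⟨p, q, r, rfl⟩ : ∃ p q r : ℝ, P = C p * X ^ 2 + C q * X + C r :=
    ⟨_, _, _, eq_quadratic_of_degree_le_two hP⟩
  have h₁ (y : ℝ) : (derivative (C p * X ^ 2 + C q * X + C r)).eval y = 2 * p * y + q := by
    simp
    ring
  have h₂ (y : ℝ) :
      (derivative (derivative (C p * X ^ 2 + C q * X + C r))).eval y = 2 * p := by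
    simp
    ring
  have i₁ : ∫ y in (x - h / 2)..(x + h / 2), (2 * p * y + q) ^ 2
      = h * (2 * p * x + q) ^ 2 + p ^ 2 * h ^ 3 / 3 := by
    have hd (y : ℝ) : HasDerivAt
        (fun y : ℝ => 4 * p ^ 2 / 3 * y ^ 3 + 2 * p * q * y ^ 2 + q ^ 2 * y)
        ((2 * p * y + q) ^ 2) y := by
      refine HasDerivAt.congr_deriv ((((hasDerivAt_pow 3 y).const_mul (4 * p ^ 2 / 3)).add
        ((hasDerivAt_pow 2 y).const_mul (2 * p * q))).add
        ((hasDerivAt_id' y).const_mul (q ^ 2))) ?_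
      push_cast
      ring
    rw [intervalIntegral.integral_eq_sub_of_hasDerivAt (fun y _ => hd y)
      (Continuous.intervalIntegrable (by fun_prop) _ _)]
    ring
  simp only [h₁, h₂, i₁, intervalIntegral.integral_const, smul_eq_mul]
  simp only [eval_add, eval_mul, eval_C, eval_pow, eval_X] at ha hb hc
  subst ha hb hc
  ring


/-- Closed-form evaluation of the boundary WENO smoothness indicators on the first
boundary cell: with equispaced nodes `ξ_m = x1 + (m-1)Δξ`, values `U1, …, U5`, and
`P0, P1, P2` the quadratic interpolants on the one-sided substencils `{ξ1,ξ2,ξ3}`,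
`{ξ2,ξ3,ξ4}`, `{ξ3,ξ4,ξ5}`, the smoothness indicators
`β_{i,1} = Σ_{r=1}^2 (Δξ)^{2r-1} ∫_{[ξ1-Δξ/2, ξ1+Δξ/2]} (P_i^{(r)})²`
have the stated closed forms. -/
theorem boundary_WENO_smoothness_indicators_first_cell
    (Δξ x1 : ℝ) (hΔ : 0 < Δξ)
    (U1 U2 U3 U4 U5 : ℝ) (P0 P1 P2 : Polynomial ℝ)
    (hP0 : P0.degree ≤ 2 ∧ P0.eval x1 = U1 ∧ P0.eval (x1 + Δξ) = U2 ∧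
      P0.eval (x1 + 2 * Δξ) = U3)
    (hP1 : P1.degree ≤ 2 ∧ P1.eval (x1 + Δξ) = U2 ∧ P1.eval (x1 + 2 * Δξ) = U3 ∧
      P1.eval (x1 + 3 * Δξ) = U4)
    (hP2 : P2.degree ≤ 2 ∧ P2.eval (x1 + 2 * Δξ) = U3 ∧ P2.eval (x1 + 3 * Δξ) = U4 ∧
      P2.eval (x1 + 4 * Δξ) = U5) :
    (Δξ * (∫ x in (x1 - Δξ / 2)..(x1 + Δξ / 2), ((Polynomial.derivative P0).eval x) ^ 2)
        + Δξ ^ 3 * (∫ x in (x1 - Δξ / 2)..(x1 + Δξ / 2),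
            ((Polynomial.derivative (Polynomial.derivative P0)).eval x) ^ 2)
      = 1 / 3 * (10 * U1 ^ 2 - 31 * U1 * U2 + 25 * U2 ^ 2 + 11 * U1 * U3
          - 19 * U2 * U3 + 4 * U3 ^ 2)) ∧
    (Δξ * (∫ x in (x1 - Δξ / 2)..(x1 + Δξ / 2), ((Polynomial.derivative P1).eval x) ^ 2)
        + Δξ ^ 3 * (∫ x in (x1 - Δξ / 2)..(x1 + Δξ / 2),
            ((Polynomial.derivative (Polynomial.derivative P1)).eval x) ^ 2)
      = 1 / 3 * (22 * U2 ^ 2 - 73 * U2 * U3 + 61 * U3 ^ 2 + 29 * U2 * U4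
          - 49 * U3 * U4 + 10 * U4 ^ 2)) ∧
    (Δξ * (∫ x in (x1 - Δξ / 2)..(x1 + Δξ / 2), ((Polynomial.derivative P2).eval x) ^ 2)
        + Δξ ^ 3 * (∫ x in (x1 - Δξ / 2)..(x1 + Δξ / 2),
            ((Polynomial.derivative (Polynomial.derivative P2)).eval x) ^ 2)
      = 1 / 3 * (40 * U3 ^ 2 - 139 * U3 * U4 + 121 * U4 ^ 2 + 59 * U3 * U5
          - 103 * U4 * U5 + 22 * U5 ^ 2)) := by
  obtain ⟨d0, a0, b0, c0⟩ := hP0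
  obtain ⟨d1, a1, b1, c1⟩ := hP1
  obtain ⟨d2, a2, b2, c2⟩ := hP2
  refine ⟨?_, ?_, ?_⟩
  · rw [smoothness_indicator_of_degree_le_two (a := U1) (b := U2) (c := U3)
      Δξ x1 0 P0 d0 (by simpa using a0)
      (by simpa using b0) (by simpa using c0)]
    ring
  · rw [smoothness_indicator_of_degree_le_two (a := U2) (b := U3) (c := U4)
      Δξ x1 1 P1 d1 (by simpa using a1)
      (by norm_num [b1]) (by norm_num [c1])]
    ring
  · rw [smoothness_indicator_of_degree_le_two (a := U3) (b := U4) (c := U5)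
      Δξ x1 2 P2 d2 a2
      (by norm_num [b2]) (by norm_num [c2])]
    ring
end

section
/- Closed-form evaluation of the boundary WENO smoothness indicators on the second boundary cell: let Δξ > 0, let ξ_1, …, ξ_5 be equispaced nodes with spacing Δξ, fix real values U_1, …, U_5, and let P_0, P_1, P_2 be the quadratic interpolants of these values on the stencils {ξ_1, ξ_2, ξ_3}, {ξ_2, ξ_3, ξ_4}, {ξ_3, ξ_4, ξ_5}, respectively. Define β_{i,2} = Σ_{r=1}^{2} (Δξ)^{2r−1} ∫_{ξ_2 − Δξ/2}^{ξ_2 + Δξ/2} (d^r P_i/dξ^r)² dξ. Then β_{0,2} = (1/3)[4U_1² − 13U_1U_2 + 13U_2² + 5U_1U_3 − 13U_2U_3 + 4U_3²], β_{1,2} = (1/3)[10U_2² − 31U_2U_3 + 25U_3² + 11U_2U_4 − 19U_3U_4 + 4U_4²], and β_{2,2} = (1/3)[22U_3² − 73U_3U_4 + 61U_4² + 29U_3U_5 − 49U_4U_5 + 10U_5²]. -/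
open Polynomial in
/-- The smoothness indicator, on a cell of width `h` centred at `m`, of a quadratic polynomial
with leading coefficient `a` and derivative `2 * a * x + b`. -/
theorem smoothness_indicator_quadratic (a b c h m : ℝ) :
    h * (∫ x in (m - h / 2)..(m + h / 2),
          ((derivative (C a * X ^ 2 + C b * X + C c)).eval x) ^ 2)
        + h ^ 3 * (∫ x in (m - h / 2)..(m + h / 2),
            ((derivative (derivative (C a * X ^ 2 + C b * X + C c))).eval x) ^ 2)
      = (h * (2 * a * m + b)) ^ 2 + 13 / 3 * (a * h ^ 2) ^ 2 := by
  have eval_deriv (x : ℝ) : ((derivative (C a * X ^ 2 + C b * X + C c)).eval x) ^ 2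
      = 4 * a ^ 2 * x ^ 2 + 4 * a * b * x + b ^ 2 := by
    simp
    ring
  have eval_deriv2 (x : ℝ) :
      ((derivative (derivative (C a * X ^ 2 + C b * X + C c))).eval x) ^ 2 = 4 * a ^ 2 := by
    simp
    ring
  simp only [eval_deriv, eval_deriv2]
  rw [intervalIntegral.integral_add (Continuous.intervalIntegrable (by fun_prop) _ _)
      (Continuous.intervalIntegrable (by fun_prop) _ _),
    intervalIntegral.integral_add (Continuous.intervalIntegrable (by fun_prop) _ _)
      (Continuous.intervalIntegrable (by fun_prop) _ _),
    intervalIntegral.integral_const_mul, intervalIntegral.integral_const_mul,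
    integral_pow, integral_id, intervalIntegral.integral_const, intervalIntegral.integral_const]
  simp only [smul_eq_mul]
  push_cast
  ring

/-- Closed-form evaluation of the boundary WENO smoothness indicators on the second
boundary cell: with equispaced nodes `ξ_m = x1 + (m-1)Δξ`, values `U1, …, U5`, and
`P0, P1, P2` the quadratic interpolants on the one-sided substencils `{ξ1,ξ2,ξ3}`,
`{ξ2,ξ3,ξ4}`, `{ξ3,ξ4,ξ5}`, the smoothness indicators
`β_{i,2} = Σ_{r=1}^2 (Δξ)^{2r-1} ∫_{[ξ2-Δξ/2, ξ2+Δξ/2]} (P_i^{(r)})²`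
have the stated closed forms. -/
theorem boundary_WENO_smoothness_indicators_second_cell
    (Δξ x1 : ℝ) (hΔ : 0 < Δξ)
    (U1 U2 U3 U4 U5 : ℝ) (P0 P1 P2 : Polynomial ℝ)
    (hP0 : P0.degree ≤ 2 ∧ P0.eval x1 = U1 ∧ P0.eval (x1 + Δξ) = U2 ∧
      P0.eval (x1 + 2 * Δξ) = U3)
    (hP1 : P1.degree ≤ 2 ∧ P1.eval (x1 + Δξ) = U2 ∧ P1.eval (x1 + 2 * Δξ) = U3 ∧
      P1.eval (x1 + 3 * Δξ) = U4)
    (hP2 : P2.degree ≤ 2 ∧ P2.eval (x1 + 2 * Δξ) = U3 ∧ P2.eval (x1 + 3 * Δξ) = U4 ∧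
      P2.eval (x1 + 4 * Δξ) = U5) :
    (Δξ * (∫ x in (x1 + Δξ - Δξ / 2)..(x1 + Δξ + Δξ / 2),
          ((Polynomial.derivative P0).eval x) ^ 2)
        + Δξ ^ 3 * (∫ x in (x1 + Δξ - Δξ / 2)..(x1 + Δξ + Δξ / 2),
            ((Polynomial.derivative (Polynomial.derivative P0)).eval x) ^ 2)
      = 1 / 3 * (4 * U1 ^ 2 - 13 * U1 * U2 + 13 * U2 ^ 2 + 5 * U1 * U3
          - 13 * U2 * U3 + 4 * U3 ^ 2)) ∧
    (Δξ * (∫ x in (x1 + Δξ - Δξ / 2)..(x1 + Δξ + Δξ / 2),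
          ((Polynomial.derivative P1).eval x) ^ 2)
        + Δξ ^ 3 * (∫ x in (x1 + Δξ - Δξ / 2)..(x1 + Δξ + Δξ / 2),
            ((Polynomial.derivative (Polynomial.derivative P1)).eval x) ^ 2)
      = 1 / 3 * (10 * U2 ^ 2 - 31 * U2 * U3 + 25 * U3 ^ 2 + 11 * U2 * U4
          - 19 * U3 * U4 + 4 * U4 ^ 2)) ∧
    (Δξ * (∫ x in (x1 + Δξ - Δξ / 2)..(x1 + Δξ + Δξ / 2),
          ((Polynomial.derivative P2).eval x) ^ 2)
        + Δξ ^ 3 * (∫ x in (x1 + Δξ - Δξ / 2)..(x1 + Δξ + Δξ / 2),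
            ((Polynomial.derivative (Polynomial.derivative P2)).eval x) ^ 2)
      = 1 / 3 * (22 * U3 ^ 2 - 73 * U3 * U4 + 61 * U4 ^ 2 + 29 * U3 * U5
          - 49 * U4 * U5 + 10 * U5 ^ 2)) := by
  have quadratic (P : Polynomial ℝ) (hP : P.degree ≤ 2) : ∃ a b c : ℝ,
      P = Polynomial.C a * Polynomial.X ^ 2 + Polynomial.C b * Polynomial.X + Polynomial.C c :=
    ⟨_, _, _, Polynomial.eq_quadratic_of_degree_le_two hP⟩
  obtain ⟨hd0, rfl, h02, h03⟩ := hP0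
  obtain ⟨hd1, h12, h13, rfl⟩ := hP1
  obtain ⟨hd2, h23, h24, rfl⟩ := hP2
  obtain ⟨a0, b0, c0, rfl⟩ := quadratic P0 hd0
  obtain ⟨a1, b1, c1, rfl⟩ := quadratic P1 hd1
  obtain ⟨a2, b2, c2, rfl⟩ := quadratic P2 hd2
  simp only [smoothness_indicator_quadratic]
  refine ⟨?_, ?_, ?_⟩
  · rw [← h02, ← h03]
    simp
    ring
  · rw [← h12, ← h13]
    simp
    ring
  · rw [← h23, ← h24]
    simp
    ring
end

section
/- Positivity preservation of the one-dimensional 'draining' timestep technique: let Δx > 0, Δt > 0, let (Ū_j)_{j ∈ ℤ} be nonnegative reals, and let (F_{j+1/2})_{j ∈ ℤ} be arbitrary reals (the numerical fluxes). For each j define D_j = max(0, F_{j+1/2}) + max(0, −F_{j−1/2}) and the draining timestep Δt^drain_j = Δx · Ū_j / D_j if D_j > 0 and Δt^drain_j = Δt otherwise. For each interface define Δt_{j+1/2} = min(Δt, Δt^drain_j) if F_{j+1/2} > 0 and Δt_{j+1/2} = min(Δt, Δt^drain_{j+1}) otherwise. Then for every j ∈ ℤ, Ū_j − (Δt_{j+1/2}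 F_{j+1/2} − Δt_{j−1/2} F_{j−1/2})/Δx ≥ 0; i.e., the modified forward-Euler update with interface-dependent draining timesteps keeps the cell averages nonnegative. -/
/-- Positivity preservation of the one-dimensional "draining" timestep technique:
`F j` stands for the numerical flux `F_{j+1/2}` at the interface between cells `j`
and `j+1`, `tdrain j` is the draining timestep of cell `j`, and `tint j` is the
interface timestep `Δt_{j+1/2}`. The modified forward-Euler update with
interface-dependent draining timesteps keeps the cell averages nonnegative. -/
theorem draining_timestep_positivity_1d
    (Δx Δt : ℝ) (hΔx : 0 < Δx) (hΔt : 0 < Δt)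
    (U : ℤ → ℝ) (hU : ∀ j, 0 ≤ U j)
    (F : ℤ → ℝ)
    (D : ℤ → ℝ) (hD : ∀ j, D j = max 0 (F j) + max 0 (-F (j - 1)))
    (tdrain : ℤ → ℝ)
    (htdrain : ∀ j, tdrain j = if 0 < D j then Δx * U j / D j else Δt)
    (tint : ℤ → ℝ)
    (htint : ∀ j, tint j =
      if 0 < F j then min Δt (tdrain j) else min Δt (tdrain (j + 1))) :
    ∀ j : ℤ, 0 ≤ U j - (tint j * F j - tint (j - 1) * F (j - 1)) / Δx := by
  have htd : ∀ j, 0 ≤ tdrain j := by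
    intro j
    rw [htdrain]
    split_ifs with h
    · exact div_nonneg (mul_nonneg hΔx.le (hU j)) h.le
    · exact hΔt.le
  have hmin : ∀ j, 0 ≤ min Δt (tdrain j) := fun j => le_min hΔt.le (htd j)
  have hti : ∀ j, 0 ≤ tint j := by
    intro j
    rw [htint]
    split_ifs
    · exact hmin j
    · exact hmin (j + 1)
  intro j
  have hright : tint j * F j ≤ min Δt (tdrain j) * max 0 (F j) := by
    by_cases h : 0 < F j
    · rw [htint, if_pos h, max_eq_right h.le]
    · exact (mul_nonpos_of_nonneg_of_nonpos (hti j) (not_lt.mp h)).trans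
        (mul_nonneg (hmin j) (le_max_left _ _))
  have hleft : -(tint (j - 1) * F (j - 1)) ≤ min Δt (tdrain j) * max 0 (-F (j - 1)) := by
    by_cases h : 0 < F (j - 1)
    · exact (neg_nonpos.mpr (mul_nonneg (hti _) h.le)).trans
        (mul_nonneg (hmin j) (le_max_left _ _))
    · rw [htint, if_neg h, sub_add_cancel, max_eq_right (by linarith), mul_neg]
  have hdrain : min Δt (tdrain j) * D j ≤ Δx * U j := by
    by_cases h : 0 < D j
    · rw [← le_div_iff₀ h]
      refine (min_le_right _ _).trans_eq ?_
      rw [htdrain, if_pos h]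
    · exact (mul_nonpos_of_nonneg_of_nonpos (hmin j) (not_lt.mp h)).trans
        (mul_nonneg hΔx.le (hU j))
  rw [hD, mul_add] at hdrain
  rw [sub_nonneg, div_le_iff₀ hΔx]
  linarith
end

section
/- Positivity preservation of the two-dimensional 'draining' timestep technique: let Δx > 0, Δy > 0, Δt > 0, let (Ū_{j,k})_{(j,k) ∈ ℤ²} be nonnegative reals, and let (F_{j+1/2,k}) and (G_{j,k+1/2}) be arbitrary reals (the x- and y-directional numerical fluxes). For each (j,k) define f^drain_{j,k} = max(0, F_{j+1/2,k}) + max(0, −F_{j−1/2,k}), g^drain_{j,k} = max(0, G_{j,k+1/2}) + max(0, −G_{j,k−1/2}), and the draining timestep Δt^drain_{j,k} = Δx Δy Ū_{j,k} / (f^drain_{j,k} Δy + g^drain_{j,k} Δx) if the denominator is positive and Δt^drain_{j,k} = Δt otherwise. Define Δt_{j+1/2,k} = min(Δt, Δt^drain_{j,k}) if F_{j+1/2,k} > 0 and min(Δt, Δt^drain_{j+1,k}) otherwise, and Δt_{j,k+1/2} = min(Δt, Δt^drain_{j,k}) if G_{j,k+1/2} > 0 and min(Δt, Δt^drain_{j,k+1})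 otherwise. Then for every (j,k) ∈ ℤ², Ū_{j,k} − (Δt_{j+1/2,k} F_{j+1/2,k} − Δt_{j−1/2,k} F_{j−1/2,k})/Δx − (Δt_{j,k+1/2} G_{j,k+1/2} − Δt_{j,k−1/2} G_{j,k−1/2})/Δy ≥ 0. -/
/-- A flux weighted by the timestep of its upwind cell is at most the outflow part of the flux
weighted by the timestep `a` of the cell on the left. -/
lemma upwind_mul_le_mul_max {a b φ : ℝ} (hb : 0 ≤ b) :
    (if 0 < φ then a else b) * φ ≤ a * max 0 φ := by
  split_ifs with h
  · rw [max_eq_right h.le]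
  · rw [max_eq_left (not_lt.mp h), mul_zero]
    exact mul_nonpos_of_nonneg_of_nonpos hb (not_lt.mp h)

/-- The mirror image of `upwind_mul_le_mul_max` for the cell on the right. -/
lemma neg_upwind_mul_le_mul_max_neg {a b φ : ℝ} (ha : 0 ≤ a) :
    -((if 0 < φ then a else b) * φ) ≤ b * max 0 (-φ) := by
  split_ifs with h
  · rw [max_eq_left (neg_nonpos.mpr h.le), mul_zero]
    exact neg_nonpos.mpr (mul_nonneg ha h.le)
  · rw [max_eq_right (neg_nonneg.mpr (not_lt.mp h)), mul_neg]


/-- Positivity preservation of the two-dimensional "draining" timestep technique: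
`F j k` stands for the x-directional numerical flux `F_{j+1/2,k}` and `G j k` for
the y-directional numerical flux `G_{j,k+1/2}`; `tdrain j k` is the draining
timestep of cell `(j,k)`, and `tx j k`, `ty j k` are the interface timesteps
`Δt_{j+1/2,k}` and `Δt_{j,k+1/2}`. The modified forward-Euler update with
interface-dependent draining timesteps keeps the cell averages nonnegative. -/
theorem draining_timestep_positivity_2d
    (Δx Δy Δt : ℝ) (hΔx : 0 < Δx) (hΔy : 0 < Δy) (hΔt : 0 < Δt)
    (U : ℤ → ℤ → ℝ) (hU : ∀ j k, 0 ≤ U j k)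
    (F G : ℤ → ℤ → ℝ)
    (fdrain gdrain : ℤ → ℤ → ℝ)
    (hf : ∀ j k, fdrain j k = max 0 (F j k) + max 0 (-F (j - 1) k))
    (hg : ∀ j k, gdrain j k = max 0 (G j k) + max 0 (-G j (k - 1)))
    (tdrain : ℤ → ℤ → ℝ)
    (htdrain : ∀ j k, tdrain j k =
      if 0 < fdrain j k * Δy + gdrain j k * Δx then
        Δx * Δy * U j k / (fdrain j k * Δy + gdrain j k * Δx)
      else Δt)
    (tx ty : ℤ → ℤ → ℝ)
    (htx : ∀ j k, tx j k =
      if 0 < F j k then min Δt (tdrain j k) else min Δt (tdrain (j + 1) k))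
    (hty : ∀ j k, ty j k =
      if 0 < G j k then min Δt (tdrain j k) else min Δt (tdrain j (k + 1))) :
    ∀ j k : ℤ,
      0 ≤ U j k - (tx j k * F j k - tx (j - 1) k * F (j - 1) k) / Δx
            - (ty j k * G j k - ty j (k - 1) * G j (k - 1)) / Δy := by
  intro j k
  have htau : ∀ j k, 0 ≤ min Δt (tdrain j k) := by
    intro j k
    refine le_min hΔt.le ?_
    rw [htdrain]
    split_ifs with h
    · exact div_nonneg (mul_nonneg (mul_pos hΔx hΔy).le (hU j k)) h.le
    · exact hΔt.le
  have hdrain : min Δt (tdrain j k) * (fdrain j k * Δy + gdrain j k * Δx)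
      ≤ Δx * Δy * U j k := by
    by_cases h : 0 < fdrain j k * Δy + gdrain j k * Δx
    · rw [← le_div_iff₀ h]
      have ht := htdrain j k
      rw [if_pos h] at ht
      exact (min_le_right _ _).trans_eq ht
    · exact (mul_nonpos_of_nonneg_of_nonpos (htau j k) (not_lt.mp h)).trans
        (mul_nonneg (mul_pos hΔx hΔy).le (hU j k))
  have hright : tx j k * F j k ≤ min Δt (tdrain j k) * max 0 (F j k) := by
    rw [htx]
    exact upwind_mul_le_mul_max (htau _ _)
  have hleft : -(tx (j - 1) k * F (j - 1) k)
      ≤ min Δt (tdrain j k) * max 0 (-F (j - 1) k) := by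
    rw [htx, sub_add_cancel]
    exact neg_upwind_mul_le_mul_max_neg (htau _ _)
  have htop : ty j k * G j k ≤ min Δt (tdrain j k) * max 0 (G j k) := by
    rw [hty]
    exact upwind_mul_le_mul_max (htau _ _)
  have hbottom : -(ty j (k - 1) * G j (k - 1))
      ≤ min Δt (tdrain j k) * max 0 (-G j (k - 1)) := by
    rw [hty, sub_add_cancel]
    exact neg_upwind_mul_le_mul_max_neg (htau _ _)
  have hx : tx j k * F j k - tx (j - 1) k * F (j - 1) k
      ≤ min Δt (tdrain j k) * fdrain j k := by
    rw [hf, mul_add]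
    linarith
  have hy : ty j k * G j k - ty j (k - 1) * G j (k - 1)
      ≤ min Δt (tdrain j k) * gdrain j k := by
    rw [hg, mul_add]
    linarith
  have hx' := mul_le_mul_of_nonneg_right hx hΔy.le
  have hy' := mul_le_mul_of_nonneg_right hy hΔx.le
  rw [sub_sub, sub_nonneg, div_add_div _ _ hΔx.ne' hΔy.ne', div_le_iff₀ (mul_pos hΔx hΔy)]
  linarith
end
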